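/- Fix b ∈ (0,3) and let u be a global classical H² solution with nonnegative momentum of the b-family equation. Set λ(t) = t^{1/2}/log t and define the energy functional 𝓔(t) = ∫_ℝ sech²(x/λ(t)) m(t,x) dx. Then there exist C > 0 and t₀ > e such that for all t ≥ t₀, | d𝓔/dt (t) | ≤ C ( 1/(t (log t)²) + (log t)/t^{3/2} + (1/λ(t)) ∫_ℝ sech²(x/λ(t)) ( u(t,x)² + (∂_x u)(t,x)² ) dx ). -/

import Mathlib

open MeasureTheory Real Filter

/-- Convolution with the Green's function of `1 - d²/dx²` on `ℝ`. -/
noncomputable def G (f : ℝ → ℝ) (x : ℝ) : ℝ :=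
  (1 / 2) * ∫ y : ℝ, Real.exp (-|x - y|) * f y

/-- The flux of the nonlocal `b`-family equation at time `t`:
`(1/2)u² + G((b/2)u² + ((3-b)/2)(∂ₓu)²)`. -/
noncomputable def flux (b : ℝ) (u : ℝ → ℝ → ℝ) (t : ℝ) : ℝ → ℝ :=
  fun y => (1 / 2) * (u t y) ^ 2
    + G (fun z => (b / 2) * (u t z) ^ 2 + ((3 - b) / 2) * (deriv (u t) z) ^ 2) y

/-- The momentum `m = u - ∂ₓ²u`. -/
noncomputable def mom (u : ℝ → ℝ → ℝ) (t x : ℝ) : ℝ :=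
  u t x - deriv (deriv (u t)) x

/-- `λ_c(t) = t^c / log t`. -/
noncomputable def lam (c t : ℝ) : ℝ := t ^ c / Real.log t

/-- `sech² z`. -/
noncomputable def sech2 (z : ℝ) : ℝ := (1 / Real.cosh z) ^ 2

/-- A global classical `H²` solution with nonnegative momentum of the nonlocal `b`-family
equation: `C¹` in `t`, `C³` in `x`, jointly continuous partial derivatives, solving the
equation pointwise on `(0,∞) × ℝ`, with `u(t,·), ∂ₓu(t,·), ∂ₓ²u(t,·) ∈ L¹(ℝ) ∩ L²(ℝ)`,
nonnegative momentum `m(t,·) ≥ 0`, and conserved total momentum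
`∫ m(t,x) dx = ∫ m(0,x) dx`. -/
def IsH2NonnegMomentumSolution (b : ℝ) (u : ℝ → ℝ → ℝ) : Prop :=
  (∀ x : ℝ, ContDiff ℝ 1 fun t => u t x) ∧
  (∀ t : ℝ, ContDiff ℝ 3 (u t)) ∧
  Continuous (fun p : ℝ × ℝ => u p.1 p.2) ∧
  Continuous (fun p : ℝ × ℝ => deriv (fun s => u s p.2) p.1) ∧
  Continuous (fun p : ℝ × ℝ => deriv (u p.1) p.2) ∧
  Continuous (fun p : ℝ × ℝ => deriv (deriv (u p.1)) p.2) ∧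
  Continuous (fun p : ℝ × ℝ => deriv (fun s => deriv (u s) p.2) p.1) ∧
  Continuous (fun p : ℝ × ℝ => deriv (fun s => deriv (deriv (u s)) p.2) p.1) ∧
  (∀ t x : ℝ, 0 < t → deriv (fun s => u s x) t + deriv (flux b u t) x = 0) ∧
  (∀ t : ℝ, 0 ≤ t →
    Integrable (u t) ∧ Integrable (fun x => (u t x) ^ 2)
    ∧ Integrable (deriv (u t)) ∧ Integrable (fun x => (deriv (u t) x) ^ 2)
    ∧ Integrable (deriv (deriv (u t))) ∧ Integrable (fun x => (deriv (deriv (u t)) x) ^ 2)) ∧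
  (∀ t x : ℝ, 0 ≤ t → 0 ≤ mom u t x) ∧
  (∀ t : ℝ, 0 ≤ t → ∫ x : ℝ, mom u t x = ∫ x : ℝ, mom u 0 x)

/-- The energy functional `𝓔(t) = ∫ sech²(x/λ(t)) m(t,x) dx` with `λ(t) = √t/log t`. -/
noncomputable def Efun (u : ℝ → ℝ → ℝ) (t : ℝ) : ℝ :=
  ∫ x : ℝ, sech2 (x / lam (1 / 2) t) * mom u t x


section aux

lemma aux_tanh (z : ℝ) : HasDerivAt Real.tanh (sech2 z) z := by
  have h : Real.tanh = fun z => Real.sinh z / Real.cosh z := by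
    funext z; exact Real.tanh_eq_sinh_div_cosh z
  rw [h]
  have hc := (Real.cosh_pos z).ne'
  refine ((Real.hasDerivAt_sinh z).div (Real.hasDerivAt_cosh z) hc).congr_deriv ?_
  unfold sech2
  have := Real.cosh_sq z
  field_simp
  linarith

lemma aux_sech2 (z : ℝ) : HasDerivAt sech2 (-2 * Real.tanh z * sech2 z) z := by
  have hc := (Real.cosh_pos z).ne'
  have h : HasDerivAt (fun z => (1 / Real.cosh z) ^ 2) (-2 * Real.tanh z * sech2 z) z := by
    have h1 := ((hasDerivAt_const z (1 : ℝ)).div (Real.hasDerivAt_cosh z) hc).pow 2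
    refine h1.congr_deriv ?_
    rw [Real.tanh_eq_sinh_div_cosh]
    unfold sech2
    simp
    field_simp
  exact h

lemma aux_sech2_eq (z : ℝ) : Real.tanh z ^ 2 = 1 - sech2 z := by
  have hc := (Real.cosh_pos z).ne'
  have := Real.cosh_sq z
  rw [Real.tanh_eq_sinh_div_cosh]
  unfold sech2
  field_simp
  linarith

lemma aux_s_pos (z : ℝ) : 0 < sech2 z := by
  have hc := (Real.cosh_pos z)
  unfold sech2; positivity

lemma aux_s_le (z : ℝ) : sech2 z ≤ 1 := by
  nlinarith [aux_sech2_eq z, sq_nonneg (Real.tanh z)]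

lemma aux_s_decay (z : ℝ) : (1 + |z|) ^ 2 * sech2 z ≤ 8 * (1 + z ^ 2)⁻¹ := by
  have h1 : 1 + z ^ 2 / 2 ≤ Real.cosh z := by
    have h2 := Real.cosh_two_mul (z / 2)
    have h3 := Real.cosh_sq (z / 2)
    have h4 : (z / 2) ^ 2 ≤ Real.sinh (z / 2) ^ 2 := by
      rw [sq_le_sq, Real.abs_sinh]
      exact Real.self_le_sinh_iff.2 (abs_nonneg _)
    rw [show 2 * (z / 2) = z by ring] at h2
    nlinarith
  have hc := Real.cosh_pos z
  unfold sech2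
  rw [div_pow, one_pow, ← sq_abs z, mul_one_div, ← div_eq_mul_inv]
  rw [← sq_abs z] at h1
  set a := |z|
  have ha : 0 ≤ a := abs_nonneg z
  rw [div_le_div_iff₀ (by positivity) (by positivity)]
  have h5 : (1 + a ^ 2 / 2) ^ 2 ≤ Real.cosh z ^ 2 := by gcongr
  have h6 : (1 + a) ^ 2 ≤ 2 * (1 + a ^ 2) := by nlinarith [sq_nonneg (a - 1)]
  have h7 : (1 + a) ^ 2 * (1 + a ^ 2) ≤ 2 * (1 + a ^ 2) * (1 + a ^ 2) := by gcongr
  nlinarith [sq_nonneg (a ^ 2)]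

lemma aux_s_mono {y z : ℝ} (h : |y| ≤ |z|) : sech2 z ≤ sech2 y := by
  have := Real.cosh_le_cosh.2 h
  have hc := Real.cosh_pos y
  unfold sech2
  gcongr

lemma aux_s_cont : Continuous sech2 :=
  continuous_iff_continuousAt.2 fun z => (aux_sech2 z).continuousAt

lemma aux_t_cont : Continuous Real.tanh :=
  continuous_iff_continuousAt.2 fun z => (aux_tanh z).continuousAt

lemma aux_int0 : Integrable (fun z : ℝ => (1 + |z|) ^ 2 * sech2 z) := by
  refine (integrable_inv_one_add_sq.const_mul 8).mono' ?_ ?_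
  · have := aux_s_cont
    exact Continuous.aestronglyMeasurable (by fun_prop)
  · refine Filter.Eventually.of_forall fun z => ?_
    have := aux_s_pos z
    rw [Real.norm_of_nonneg (by positivity)]
    exact aux_s_decay z

lemma aux_int {c : ℝ} (hc : c ≠ 0) :
    Integrable (fun x : ℝ => (1 + |c * x|) ^ 2 * sech2 (c * x)) :=
  aux_int0.comp_mul_left' hc

lemma aux_int' {c : ℝ} (hc : c ≠ 0) :
    Integrable (fun x : ℝ => sech2 (c * x)) := by
  refine (aux_int hc).mono' ?_ ?_
  · have := aux_s_cont
    exact Continuous.aestronglyMeasurable (by fun_prop)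
  · refine Filter.Eventually.of_forall fun z => ?_
    have := aux_s_pos (c * z)
    rw [Real.norm_of_nonneg (by positivity)]
    have : 1 ≤ (1 + |c * z|) ^ 2 := by nlinarith [abs_nonneg (c * z)]
    nlinarith

/-- integrability against the weight -/
lemma aux_intmul {c K : ℝ} (hc : c ≠ 0) {g : ℝ → ℝ} (hg : Continuous g)
    (hb : ∀ x, |g x| ≤ K * sech2 (c * x)) : Integrable g := by
  refine ((aux_int' hc).const_mul K).mono' hg.aestronglyMeasurable ?_
  exact Filter.Eventually.of_forall hb

noncomputable def phi1 (μ x : ℝ) : ℝ := -2 * μ * (Real.tanh (μ * x) * sech2 (μ * x))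
noncomputable def phi2 (μ x : ℝ) : ℝ := μ ^ 2 * (4 * sech2 (μ * x) - 6 * sech2 (μ * x) ^ 2)
noncomputable def phi3 (μ x : ℝ) : ℝ :=
  -2 * μ ^ 3 * (Real.tanh (μ * x) * sech2 (μ * x) * (4 - 12 * sech2 (μ * x)))
noncomputable def psimu (μ x : ℝ) : ℝ :=
  x * (-2 * Real.tanh (μ * x) * sech2 (μ * x))
    - 2 * μ * (4 * sech2 (μ * x) - 6 * sech2 (μ * x) ^ 2)
    + 2 * μ ^ 2 * x * (Real.tanh (μ * x) * sech2 (μ * x) * (4 - 12 * sech2 (μ * x)))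

lemma aux_ts (y : ℝ) : |Real.tanh y * sech2 y| ≤ sech2 y := by
  have := Real.abs_tanh_lt_one y
  have h2 := aux_s_pos y
  rw [abs_mul, abs_of_pos h2]
  nlinarith

lemma aux_tss (y : ℝ) : |Real.tanh y * sech2 y * (4 - 12 * sech2 y)| ≤ 8 * sech2 y := by
  have := aux_ts y
  have h2 := aux_s_pos y
  have h1 := aux_s_le y
  have h3 : |4 - 12 * sech2 y| ≤ 8 := by rw [abs_le]; constructor <;> linarith
  rw [abs_mul, mul_comm (8 : ℝ)]
  gcongr

lemma aux_ss (y : ℝ) : |4 * sech2 y - 6 * sech2 y ^ 2| ≤ 4 * sech2 y := by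
  have h2 := aux_s_pos y
  have h1 := aux_s_le y
  rw [abs_le]; constructor <;> nlinarith

lemma aux_phi1_b {μ : ℝ} (hμ : 0 ≤ μ) (x : ℝ) : |phi1 μ x| ≤ 2 * μ * sech2 (μ * x) := by
  unfold phi1
  rw [abs_mul, show |(-2 * μ)| = 2 * μ by rw [neg_mul, abs_neg, abs_of_nonneg (by positivity)]]
  have := aux_ts (μ * x)
  gcongr

lemma aux_phi2_b (μ : ℝ) (x : ℝ) : |phi2 μ x| ≤ 4 * μ ^ 2 * sech2 (μ * x) := by
  unfold phi2
  rw [abs_mul, abs_of_nonneg (by positivity : 0 ≤ μ ^ 2)]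
  have := aux_ss (μ * x)
  nlinarith [sq_nonneg μ]

lemma aux_phi3_b {μ : ℝ} (hμ : 0 ≤ μ) (x : ℝ) : |phi3 μ x| ≤ 16 * μ ^ 3 * sech2 (μ * x) := by
  unfold phi3
  rw [abs_mul, show |(-2 * μ ^ 3)| = 2 * μ ^ 3 by
    rw [neg_mul, abs_neg, abs_of_nonneg (by positivity)]]
  have := aux_tss (μ * x)
  have h3 : 0 ≤ μ ^ 3 := by positivity
  nlinarith

lemma aux_psimu_b {μ : ℝ} (hμ : 0 < μ) (h2 : μ ≤ 2) (x : ℝ) :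
    μ * |psimu μ x| ≤ 66 * ((1 + |μ * x|) * sech2 (μ * x)) := by
  have e : μ * |psimu μ x| = |-2 * ((μ * x) * (Real.tanh (μ * x) * sech2 (μ * x)))
    + -2 * (μ ^ 2 * (4 * sech2 (μ * x) - 6 * sech2 (μ * x) ^ 2))
    + 2 * (μ ^ 2 * ((μ * x) * (Real.tanh (μ * x) * sech2 (μ * x) * (4 - 12 * sech2 (μ * x)))))| := by
    conv_lhs => rw [← abs_of_pos hμ, ← abs_mul, abs_of_pos hμ]
    congr 1
    unfold psimu; ring
  rw [e]
  refine (abs_add_three _ _ _).trans ?_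
  set y := μ * x
  simp only [abs_mul, abs_neg, abs_two]
  rw [← abs_mul, ← abs_mul (Real.tanh y * sech2 y), abs_of_nonneg (by positivity : 0 ≤ μ ^ 2)]
  have a1 := aux_ts y
  have a2 := aux_ss y
  have a3 := aux_tss y
  have s0 := aux_s_pos y
  have m4 : μ ^ 2 ≤ 4 := by nlinarith
  have b1 : |y| * |Real.tanh y * sech2 y| ≤ |y| * sech2 y := by gcongr
  have b2 : μ ^ 2 * |4 * sech2 y - 6 * sech2 y ^ 2| ≤ 4 * (4 * sech2 y) := by gcongr
  have b3 : μ ^ 2 * (|y| * |Real.tanh y * sech2 y * (4 - 12 * sech2 y)|)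
    ≤ 4 * (|y| * (8 * sech2 y)) := by gcongr
  nlinarith

lemma aux_phi_d (μ x : ℝ) : HasDerivAt (fun x => sech2 (μ * x)) (phi1 μ x) x := by
  have h := (aux_sech2 (μ * x)).comp x ((hasDerivAt_id x).const_mul μ)
  refine h.congr_deriv ?_
  unfold phi1; ring

lemma aux_tanh_d (μ x : ℝ) : HasDerivAt (fun x => Real.tanh (μ * x)) (μ * sech2 (μ * x)) x := by
  have h := (aux_tanh (μ * x)).comp x ((hasDerivAt_id x).const_mul μ)
  refine h.congr_deriv ?_
  ring

lemma aux_phi1_d (μ x : ℝ) : HasDerivAt (phi1 μ) (phi2 μ x) x := by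
  have h := ((aux_tanh_d μ x).mul (aux_phi_d μ x)).const_mul (-2 * μ)
  refine h.congr_deriv ?_
  have := aux_sech2_eq (μ * x)
  unfold phi1 phi2
  linear_combination (4 * μ ^ 2 * sech2 (μ * x)) * this

lemma aux_phi2_d (μ x : ℝ) : HasDerivAt (phi2 μ) (phi3 μ x) x := by
  have h := (((aux_phi_d μ x).const_mul 4).sub (((aux_phi_d μ x).pow 2).const_mul 6)).const_mul
    (μ ^ 2)
  refine h.congr_deriv ?_
  unfold phi1 phi3
  simp only [Nat.cast_ofNat, Nat.add_one_sub_one, pow_one]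
  ring

lemma aux_psimu_d (μ x : ℝ) :
    HasDerivAt (fun μ => sech2 (μ * x) - phi2 μ x) (psimu μ x) μ := by
  have h0 : HasDerivAt (fun μ => sech2 (μ * x)) (-2 * Real.tanh (μ * x) * sech2 (μ * x) * x) μ := by
    have h := (aux_sech2 (μ * x)).comp μ ((hasDerivAt_id μ).mul_const x)
    refine h.congr_deriv ?_
    ring
  have h := h0.sub (((hasDerivAt_id μ).pow 2).mul ((h0.const_mul 4).sub ((h0.pow 2).const_mul 6)))
  refine h.congr_deriv ?_
  unfold psimu
  simp
  ring

/-- Properties of the Green operator -/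
lemma aux_G {f : ℝ → ℝ} (hf : Continuous f) {K : ℝ} (h0 : ∀ x, 0 ≤ f x) (hK : ∀ x, f x ≤ K) :
    ∃ g1 : ℝ → ℝ, (∀ x, HasDerivAt (G f) (g1 x) x) ∧ (∀ x, HasDerivAt g1 (G f x - f x) x) ∧
      (∀ x, |G f x| ≤ K) ∧ (∀ x, |g1 x| ≤ K) := by
  have iA : ∀ x, IntegrableOn (fun y => Real.exp y * f y) (Set.Iic x) := fun x => by
    refine ((integrableOn_exp_Iic x).mul_const K).mono'
      (Continuous.aestronglyMeasurable (by fun_prop)) (Filter.Eventually.of_forall fun y => ?_)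
    rw [Real.norm_of_nonneg (mul_nonneg (Real.exp_pos y).le (h0 y))]
    exact mul_le_mul_of_nonneg_left (hK y) (Real.exp_pos y).le
  have iB : ∀ x, IntegrableOn (fun y => Real.exp (-y) * f y) (Set.Ioi x) := fun x => by
    refine ((integrableOn_exp_neg_Ioi x).mul_const K).mono'
      (Continuous.aestronglyMeasurable (by fun_prop)) (Filter.Eventually.of_forall fun y => ?_)
    rw [Real.norm_of_nonneg (mul_nonneg (Real.exp_pos _).le (h0 y))]
    exact mul_le_mul_of_nonneg_left (hK y) (Real.exp_pos _).le
  set A : ℝ → ℝ := fun x => ∫ y in Set.Iic x, Real.exp y * f y with hA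
  set B : ℝ → ℝ := fun x => ∫ y in Set.Ioi x, Real.exp (-y) * f y with hB
  have dA : ∀ x, HasDerivAt A (Real.exp x * f x) x := fun x => by
    have e : A = fun x => A 0 + ∫ y in (0:ℝ)..x, Real.exp y * f y := by
      funext z
      rw [← intervalIntegral.integral_Iic_sub_Iic (iA 0) (iA z)]; simp [hA]
    rw [e]
    have hc : Continuous (fun y => Real.exp y * f y) := by fun_prop
    exact (intervalIntegral.integral_hasDerivAt_right (hc.intervalIntegrable _ _)
      hc.stronglyMeasurable.stronglyMeasurableAtFilter hc.continuousAt).const_add _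
  have dB : ∀ x, HasDerivAt B (-(Real.exp (-x) * f x)) x := fun x => by
    have e : B = fun x => B 0 - ∫ y in (0:ℝ)..x, Real.exp (-y) * f y := by
      funext z
      rw [← intervalIntegral.integral_Ioi_sub_Ioi' (iB 0) (iB z)]; simp [hB]
    rw [e]
    have hc : Continuous (fun y => Real.exp (-y) * f y) := by fun_prop
    exact (intervalIntegral.integral_hasDerivAt_right (hc.intervalIntegrable _ _)
      hc.stronglyMeasurable.stronglyMeasurableAtFilter hc.continuousAt).const_sub _
  have bA0 : ∀ x, 0 ≤ A x := fun x =>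
    integral_nonneg fun y => mul_nonneg (Real.exp_pos _).le (h0 y)
  have bB0 : ∀ x, 0 ≤ B x := fun x =>
    integral_nonneg fun y => mul_nonneg (Real.exp_pos _).le (h0 y)
  have bA : ∀ x, Real.exp (-x) * A x ≤ K := fun x => by
    have : A x ≤ ∫ y in Set.Iic x, Real.exp y * K :=
      integral_mono (iA x) ((integrableOn_exp_Iic x).mul_const K)
        fun y => mul_le_mul_of_nonneg_left (hK y) (Real.exp_pos _).le
    rw [integral_mul_const, integral_exp_Iic] at this
    calc Real.exp (-x) * A x ≤ Real.exp (-x) * (Real.exp x * K) := by gcongr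
      _ = K := by rw [← mul_assoc, ← Real.exp_add]; simp
  have bB : ∀ x, Real.exp x * B x ≤ K := fun x => by
    have : B x ≤ ∫ y in Set.Ioi x, Real.exp (-y) * K :=
      integral_mono (iB x) ((integrableOn_exp_neg_Ioi x).mul_const K)
        fun y => mul_le_mul_of_nonneg_left (hK y) (Real.exp_pos _).le
    rw [integral_mul_const, integral_exp_neg_Ioi] at this
    calc Real.exp x * B x ≤ Real.exp x * (Real.exp (-x) * K) := by gcongr
      _ = K := by rw [← mul_assoc, ← Real.exp_add]; simp
  have eG : ∀ x, G f x = (Real.exp (-x) * A x + Real.exp x * B x) / 2 := fun x => by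
    have e1 : Set.EqOn (fun y => Real.exp (-|x - y|) * f y)
        (fun y => Real.exp (-x) * (Real.exp y * f y)) (Set.Iic x) := fun y hy => by
      have : 0 ≤ x - y := sub_nonneg.2 hy
      simp only
      rw [abs_of_nonneg this, ← mul_assoc, ← Real.exp_add]; ring_nf
    have e2 : Set.EqOn (fun y => Real.exp (-|x - y|) * f y)
        (fun y => Real.exp x * (Real.exp (-y) * f y)) (Set.Ioi x) := fun y hy => by
      have : x - y ≤ 0 := sub_nonpos.2 (le_of_lt hy)
      simp only
      rw [abs_of_nonpos this, ← mul_assoc, ← Real.exp_add]; ring_nf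
    unfold G
    rw [← intervalIntegral.integral_Iic_add_Ioi (b := x)
      (IntegrableOn.congr_fun ((iA x).const_mul _) e1.symm measurableSet_Iic)
      (IntegrableOn.congr_fun ((iB x).const_mul _) e2.symm measurableSet_Ioi),
      setIntegral_congr_fun measurableSet_Iic e1, setIntegral_congr_fun measurableSet_Ioi e2,
      integral_const_mul, integral_const_mul]
    ring
  have eG' : G f = fun x => (Real.exp (-x) * A x + Real.exp x * B x) / 2 := funext eG
  have dn : ∀ x : ℝ, HasDerivAt (fun x : ℝ => Real.exp (-x)) (-Real.exp (-x)) x := fun x => by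
    simpa using (hasDerivAt_neg x).exp
  have d1 : ∀ x, HasDerivAt (fun x => Real.exp (-x) * A x) (f x - Real.exp (-x) * A x) x :=
    fun x => by
      refine ((dn x).mul (dA x)).congr_deriv ?_
      rw [← mul_assoc, ← Real.exp_add]; simp; ring
  have d2 : ∀ x, HasDerivAt (fun x => Real.exp x * B x) (Real.exp x * B x - f x) x :=
    fun x => by
      refine ((Real.hasDerivAt_exp x).mul (dB x)).congr_deriv ?_
      rw [mul_neg, ← mul_assoc, ← Real.exp_add]; simp; ring
  refine ⟨fun x => (Real.exp x * B x - Real.exp (-x) * A x) / 2, fun x => ?_, fun x => ?_,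
    fun x => ?_, fun x => ?_⟩
  · rw [eG']
    refine (((d1 x).add (d2 x)).div_const 2).congr_deriv ?_
    ring
  · rw [eG x]
    refine (((d2 x).sub (d1 x)).div_const 2).congr_deriv ?_
    ring
  all_goals
    have p1 := mul_nonneg (Real.exp_pos (-x)).le (bA0 x)
    have p2 := mul_nonneg (Real.exp_pos x).le (bB0 x)
    have p3 := bA x
    have p4 := bB x
    first | rw [eG x] | skip
    rw [abs_le]; constructor <;> linarith

/-- Pointwise bounds from nonnegative momentum -/
lemma aux_u {v : ℝ → ℝ} (hv : ContDiff ℝ 3 v) (i0 : Integrable v) (i1 : Integrable (deriv v))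
    (i2 : Integrable (deriv (deriv v))) (hm : ∀ x, 0 ≤ v x - deriv (deriv v) x) :
    (∀ x, |deriv v x| ≤ v x) ∧ ∀ x, v x ≤ ∫ x, (v x - deriv (deriv v) x) := by
  have d0 : ∀ x, HasDerivAt v (deriv v x) x := fun x =>
    (hv.differentiable (by norm_num) x).hasDerivAt
  have hv1 : ContDiff ℝ 2 (deriv v) := by
    have : ContDiff ℝ (2 + 1) v := by norm_num; exact hv
    exact (contDiff_succ_iff_deriv.1 this).2.2
  have d1 : ∀ x, HasDerivAt (deriv v) (deriv (deriv v) x) x := fun x =>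
    (hv1.differentiable (by norm_num) x).hasDerivAt
  have t0b := tendsto_zero_of_hasDerivAt_of_integrableOn_Iic (a := 0) (fun x _ => d0 x)
    i1.integrableOn i0.integrableOn
  have t1b := tendsto_zero_of_hasDerivAt_of_integrableOn_Iic (a := 0) (fun x _ => d1 x)
    i2.integrableOn i1.integrableOn
  have t0t := tendsto_zero_of_hasDerivAt_of_integrableOn_Ioi (a := 0) (fun x _ => d0 x)
    i1.integrableOn i0.integrableOn
  have t1t := tendsto_zero_of_hasDerivAt_of_integrableOn_Ioi (a := 0) (fun x _ => d1 x)
    i2.integrableOn i1.integrableOn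
  have dn : ∀ x : ℝ, HasDerivAt (fun x : ℝ => Real.exp (-x)) (-Real.exp (-x)) x := fun x => by
    simpa using (hasDerivAt_neg x).exp
  have w1 : ∀ x, 0 ≤ v x - deriv v x := by
    have hd : ∀ x, HasDerivAt (fun x => Real.exp x * (v x - deriv v x))
        (Real.exp x * (v x - deriv (deriv v) x)) x := fun x => by
      refine ((Real.hasDerivAt_exp x).mul ((d0 x).sub (d1 x))).congr_deriv ?_
      simp only [Pi.sub_apply]
      ring
    have mono : Monotone (fun x => Real.exp x * (v x - deriv v x)) :=
      monotone_of_hasDerivAt_nonneg hd fun x => mul_nonneg (Real.exp_pos x).le (hm x)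
    have lim : Tendsto (fun x => Real.exp x * (v x - deriv v x)) atBot (nhds 0) := by
      simpa using Real.tendsto_exp_atBot.mul (t0b.sub t1b)
    intro x
    have := mono.le_of_tendsto lim x
    exact nonneg_of_mul_nonneg_right this (Real.exp_pos x)
  have w2 : ∀ x, 0 ≤ v x + deriv v x := by
    have hd : ∀ x, HasDerivAt (fun x => Real.exp (-x) * (v x + deriv v x))
        (-(Real.exp (-x) * (v x - deriv (deriv v) x))) x := fun x => by
      refine ((dn x).mul ((d0 x).add (d1 x))).congr_deriv ?_
      simp only [Pi.add_apply]
      ring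
    have mono : Antitone (fun x => Real.exp (-x) * (v x + deriv v x)) :=
      antitone_of_hasDerivAt_nonpos hd fun x => neg_nonpos.2 (mul_nonneg (Real.exp_pos _).le (hm x))
    have lim : Tendsto (fun x => Real.exp (-x) * (v x + deriv v x)) atTop (nhds 0) := by
      simpa using Real.tendsto_exp_neg_atTop_nhds_zero.mul (t0t.add t1t)
    intro x
    have := mono.le_of_tendsto lim x
    exact nonneg_of_mul_nonneg_right this (Real.exp_pos _)
  have hle : ∀ x, |deriv v x| ≤ v x := fun x => abs_le.2 ⟨by linarith [w2 x], by linarith [w1 x]⟩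
  refine ⟨hle, fun x => ?_⟩
  have z2 : ∫ x, deriv (deriv v) x = 0 := integral_eq_zero_of_hasDerivAt_of_integrable d1 i2 i1
  rw [integral_sub i0 i2, z2, sub_zero]
  have e := integral_Iic_of_hasDerivAt_of_tendsto' (a := x) (fun x _ => d0 x) i1.integrableOn t0b
  rw [sub_zero] at e
  rw [← e]
  calc ∫ y in Set.Iic x, deriv v y ≤ ∫ y in Set.Iic x, v y :=
        integral_mono i1.integrableOn i0.integrableOn fun y => (le_abs_self _).trans (hle y)
    _ ≤ ∫ y, v y := setIntegral_le_integral i0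
        (Filter.Eventually.of_forall fun y => (abs_nonneg _).trans (hle y))

lemma aux_phic (μ : ℝ) : Continuous (fun x => sech2 (μ * x)) :=
  continuous_iff_continuousAt.2 fun z => (aux_phi_d μ z).continuousAt
lemma aux_phi1c (μ : ℝ) : Continuous (phi1 μ) :=
  continuous_iff_continuousAt.2 fun z => (aux_phi1_d μ z).continuousAt
lemma aux_phi2c (μ : ℝ) : Continuous (phi2 μ) :=
  continuous_iff_continuousAt.2 fun z => (aux_phi2_d μ z).continuousAt
lemma aux_phi3c (μ : ℝ) : Continuous (phi3 μ) := by
  have := aux_phic μ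
  have := aux_t_cont
  unfold phi3
  fun_prop
lemma aux_psimuc (μ : ℝ) : Continuous (psimu μ) := by
  have := aux_phic μ
  have := aux_t_cont
  unfold psimu
  fun_prop

lemma aux_intmul2 {μ K L : ℝ} (hμ : μ ≠ 0) {p g : ℝ → ℝ} (hp : Continuous p) (hg : Continuous g)
    (hpb : ∀ x, |p x| ≤ K * sech2 (μ * x)) (hgb : ∀ x, |g x| ≤ L) :
    Integrable (fun x => p x * g x) := by
  refine aux_intmul (K := K * L) hμ (hp.mul hg) fun x => ?_
  rw [abs_mul]
  calc |p x| * |g x| ≤ (K * sech2 (μ * x)) * L :=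
        mul_le_mul (hpb x) (hgb x) (abs_nonneg _) ((abs_nonneg _).trans (hpb x))
    _ = _ := by ring

lemma aux_phi_b (μ x : ℝ) : |sech2 (μ * x)| ≤ 1 * sech2 (μ * x) := by
  rw [abs_of_pos (aux_s_pos _), one_mul]

lemma aux_psi_b (μ x : ℝ) :
    |sech2 (μ * x) - phi2 μ x| ≤ (1 + 4 * μ ^ 2) * sech2 (μ * x) := by
  refine (abs_sub _ _).trans ?_
  have := aux_phi_b μ x
  have := aux_phi2_b μ x
  linarith

lemma aux_psix_b {μ : ℝ} (hμ : 0 ≤ μ) (x : ℝ) :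
    |phi1 μ x - phi3 μ x| ≤ (2 * μ + 16 * μ ^ 3) * sech2 (μ * x) := by
  refine (abs_sub _ _).trans ?_
  have := aux_phi1_b hμ x
  have := aux_phi3_b hμ x
  linarith

lemma aux_ibp1 {v : ℝ → ℝ} (hv : ContDiff ℝ 3 v) (i2 : Integrable (deriv (deriv v))) {M : ℝ}
    (h1 : ∀ x, |deriv v x| ≤ v x) (hM : ∀ x, v x ≤ M) {μ : ℝ} (hμ : 0 < μ) :
    ∫ x, sech2 (μ * x) * (v x - deriv (deriv v) x) = ∫ x, (sech2 (μ * x) - phi2 μ x) * v x := by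
  have d0 : ∀ x, HasDerivAt v (deriv v x) x := fun x =>
    (hv.differentiable (by norm_num) x).hasDerivAt
  have hv1 : ContDiff ℝ 2 (deriv v) := by
    have : ContDiff ℝ (2 + 1) v := by norm_num; exact hv
    exact (contDiff_succ_iff_deriv.1 this).2.2
  have d1 : ∀ x, HasDerivAt (deriv v) (deriv (deriv v) x) x := fun x =>
    (hv1.differentiable (by norm_num) x).hasDerivAt
  have b0 : ∀ x, |v x| ≤ M := fun x => by
    rw [abs_of_nonneg ((abs_nonneg _).trans (h1 x))]; exact hM x
  have b1 : ∀ x, |deriv v x| ≤ M := fun x => (h1 x).trans (hM x)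
  have j1 := aux_intmul2 hμ.ne' (aux_phic μ) hv.continuous (aux_phi_b μ) b0
  have j2 := aux_intmul2 hμ.ne' (aux_phi2c μ) hv.continuous (aux_phi2_b μ) b0
  have j3 : Integrable (fun x => sech2 (μ * x) * deriv (deriv v) x) :=
    i2.bdd_mul (c := 1) (aux_phic μ).aestronglyMeasurable (Filter.Eventually.of_forall fun x => by
      rw [Real.norm_of_nonneg (aux_s_pos _).le]; exact aux_s_le _)
  have j4 := aux_intmul2 hμ.ne' (aux_phi1c μ) hv.continuous (aux_phi1_b hμ.le) b0
  have j5 := aux_intmul2 hμ.ne' (aux_phic μ) hv1.continuous (aux_phi_b μ) b1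
  have key := integral_eq_zero_of_hasDerivAt_of_integrable
    (f := fun x => phi1 μ x * v x - sech2 (μ * x) * deriv v x)
    (f' := fun x => phi2 μ x * v x - sech2 (μ * x) * deriv (deriv v) x)
    (fun x => by
      refine (((aux_phi1_d μ x).mul (d0 x)).sub ((aux_phi_d μ x).mul (d1 x))).congr_deriv ?_
      ring) (j2.sub j3) (j4.sub j5)
  rw [integral_sub j2 j3] at key
  simp only [mul_sub, sub_mul]
  rw [integral_sub j1 j3, integral_sub j1 j2]
  linarith

lemma aux_ibp2 {v g g1 f : ℝ → ℝ} (hv : ContDiff ℝ 3 v) (hf : Continuous f) {M K : ℝ}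
    (h1 : ∀ x, |deriv v x| ≤ v x) (hM : ∀ x, v x ≤ M)
    (dg : ∀ x, HasDerivAt g (g1 x) x) (dg1 : ∀ x, HasDerivAt g1 (g x - f x) x)
    (bg : ∀ x, |g x| ≤ K) (bg1 : ∀ x, |g1 x| ≤ K) (bf : ∀ x, |f x| ≤ K) {μ : ℝ} (hμ : 0 < μ) :
    Integrable (fun x => (sech2 (μ * x) - phi2 μ x) * (v x * deriv v x + g1 x)) ∧
    Integrable (fun x => phi1 μ x * f x + (phi1 μ x - phi3 μ x) * (v x ^ 2 / 2)) ∧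
    ∫ x, (sech2 (μ * x) - phi2 μ x) * (v x * deriv v x + g1 x)
      = - ∫ x, (phi1 μ x * f x + (phi1 μ x - phi3 μ x) * (v x ^ 2 / 2)) := by
  have d0 : ∀ x, HasDerivAt v (deriv v x) x := fun x =>
    (hv.differentiable (by norm_num) x).hasDerivAt
  have hv1 : ContDiff ℝ 2 (deriv v) := by
    have : ContDiff ℝ (2 + 1) v := by norm_num; exact hv
    exact (contDiff_succ_iff_deriv.1 this).2.2
  have cv := hv.continuous
  have cv1 := hv1.continuous
  have cg : Continuous g := continuous_iff_continuousAt.2 fun z => (dg z).continuousAt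
  have cg1 : Continuous g1 := continuous_iff_continuousAt.2 fun z => (dg1 z).continuousAt
  have v0 : ∀ x, 0 ≤ v x := fun x => (abs_nonneg _).trans (h1 x)
  have b2 : ∀ x, |v x ^ 2 / 2| ≤ M ^ 2 / 2 := fun x => by
    rw [abs_of_nonneg (by positivity)]
    have := v0 x
    have := hM x
    gcongr
  have b3 : ∀ x, |v x * deriv v x + g1 x| ≤ M * M + K := fun x => by
    refine (abs_add_le _ _).trans (add_le_add ?_ (bg1 x))
    rw [abs_mul, abs_of_nonneg (v0 x)]
    exact mul_le_mul (hM x) ((h1 x).trans (hM x)) (abs_nonneg _) ((v0 x).trans (hM x))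
  have cpsi : Continuous fun x => sech2 (μ * x) - phi2 μ x := (aux_phic μ).sub (aux_phi2c μ)
  have cpsix : Continuous fun x => phi1 μ x - phi3 μ x := (aux_phi1c μ).sub (aux_phi3c μ)
  have j1 : Integrable (fun x => (sech2 (μ * x) - phi2 μ x) * (v x * deriv v x + g1 x)) :=
    aux_intmul2 hμ.ne' cpsi ((cv.mul cv1).add cg1) (aux_psi_b μ) b3
  have j2 := aux_intmul2 hμ.ne' (aux_phi1c μ) hf (aux_phi1_b hμ.le) bf
  have j3 := aux_intmul2 hμ.ne' cpsix ((cv.pow 2).div_const 2) (aux_psix_b hμ.le) b2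
  have j4 := aux_intmul2 hμ.ne' cpsi ((cv.pow 2).div_const 2) (aux_psi_b μ) b2
  have j5 := aux_intmul2 hμ.ne' (aux_phic μ) cg (aux_phi_b μ) bg
  have j6 := aux_intmul2 hμ.ne' (aux_phi1c μ) cg1 (aux_phi1_b hμ.le) bg1
  have j23 : Integrable (fun x => phi1 μ x * f x + (phi1 μ x - phi3 μ x) * (v x ^ 2 / 2)) :=
    j2.add j3
  refine ⟨j1, j23, ?_⟩
  have key := integral_eq_zero_of_hasDerivAt_of_integrable
    (f := fun x => (sech2 (μ * x) - phi2 μ x) * (v x ^ 2 / 2) + sech2 (μ * x) * g x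
      - phi1 μ x * g1 x)
    (f' := fun x => (sech2 (μ * x) - phi2 μ x) * (v x * deriv v x + g1 x)
      + (phi1 μ x * f x + (phi1 μ x - phi3 μ x) * (v x ^ 2 / 2)))
    (fun x => by
      refine ((((((aux_phi_d μ x).sub (aux_phi2_d μ x)).mul (((d0 x).pow 2).div_const 2))).add
        ((aux_phi_d μ x).mul (dg x))).sub ((aux_phi1_d μ x).mul (dg1 x))).congr_deriv ?_
      simp
      ring) (j1.add j23) ((j4.add j5).sub j6)
  rw [integral_add j1 j23] at key
  linarith

/-- `1/λ` -/
noncomputable def mu (t : ℝ) : ℝ := 1 / lam (1 / 2) t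

lemma aux_mu_eq (t : ℝ) : mu t = Real.log t / Real.sqrt t := by
  unfold mu lam; rw [one_div_div, Real.sqrt_eq_rpow]

lemma aux_mu_d {t : ℝ} (ht : 0 < t) :
    HasDerivAt mu ((1 - Real.log t / 2) / (t * Real.sqrt t)) t := by
  have e : mu = fun t => Real.log t / Real.sqrt t := funext aux_mu_eq
  rw [e]
  have hs := Real.sqrt_pos.2 ht
  have h := (Real.hasDerivAt_log ht.ne').div (Real.hasDerivAt_sqrt ht.ne') hs.ne'
  refine h.congr_deriv ?_
  have h2 : t = Real.sqrt t ^ 2 := (Real.sq_sqrt ht.le).symm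
  generalize Real.log t = L
  set r := Real.sqrt t
  rw [h2]
  field_simp

lemma aux_mu_facts {t : ℝ} (ht : 2.72 ≤ t) : 0 < mu t ∧ mu t ≤ 2 ∧
    |(1 - Real.log t / 2) / (t * Real.sqrt t)| ≤ mu t / t ∧
    (1 / (t * mu t)) ^ 2 = 1 / (t * (Real.log t) ^ 2) := by
  have ht0 : 0 < t := by linarith
  have hl : 1 ≤ Real.log t := by
    rw [Real.le_log_iff_exp_le ht0]
    linarith [Real.exp_one_lt_d9]
  have hs := Real.sqrt_pos.2 ht0
  have h2 : Real.sqrt t ^ 2 = t := (Real.sq_sqrt ht0.le)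
  rw [aux_mu_eq]
  refine ⟨by positivity, ?_, ?_, ?_⟩
  · rw [div_le_iff₀ hs]
    have h3 := Real.log_le_sub_one_of_pos hs
    have h4 : Real.log t = 2 * Real.log (Real.sqrt t) := by
      rw [Real.log_sqrt ht0.le]; ring
    linarith
  · rw [abs_div, abs_of_pos (by positivity : 0 < t * Real.sqrt t), div_div, mul_comm t]
    gcongr
    rw [abs_le]; constructor <;> linarith
  · field_simp
    linarith

lemma aux_time {b : ℝ} (hb : b ∈ Set.Ioo (0 : ℝ) 3) {u : ℝ → ℝ → ℝ}
    (hu : IsH2NonnegMomentumSolution b u) {t : ℝ} (ht : 0 < t) :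
    (∀ x, |deriv (u t) x| ≤ u t x) ∧ (∀ x, u t x ≤ ∫ x, mom u 0 x) ∧
    (∀ x, |deriv (fun s => u s x) t| ≤
      (∫ x, mom u 0 x) * (∫ x, mom u 0 x) + 3 / 2 * (∫ x, mom u 0 x) ^ 2) ∧
    (∀ μ, 0 < μ → ∫ x, sech2 (μ * x) * mom u t x = ∫ x, (sech2 (μ * x) - phi2 μ x) * u t x) ∧
    (∃ f : ℝ → ℝ, (∀ x, |f x| ≤ 3 / 2 * (u t x ^ 2 + deriv (u t) x ^ 2)) ∧ ∀ μ, 0 < μ →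
      Integrable (fun x => (sech2 (μ * x) - phi2 μ x) * deriv (fun s => u s x) t) ∧
      Integrable (fun x => phi1 μ x * f x + (phi1 μ x - phi3 μ x) * (u t x ^ 2 / 2)) ∧
      ∫ x, (sech2 (μ * x) - phi2 μ x) * deriv (fun s => u s x) t
        = ∫ x, (phi1 μ x * f x + (phi1 μ x - phi3 μ x) * (u t x ^ 2 / 2))) := by
  obtain ⟨-, hC3, -, -, -, -, -, -, heq, hint, hm, hcons⟩ := hu
  obtain ⟨i0, -, i1, -, i2, -⟩ := hint t ht.le
  have hv := hC3 t
  obtain ⟨h1, hM⟩ := aux_u hv i0 i1 i2 (fun x => hm t x ht.le)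
  have hc : ∫ x, (u t x - deriv (deriv (u t)) x) = ∫ x, mom u 0 x := hcons t ht.le
  rw [hc] at hM
  set M := ∫ x, mom u 0 x with hMdef
  have v0 : ∀ x, 0 ≤ u t x := fun x => (abs_nonneg _).trans (h1 x)
  set f : ℝ → ℝ := fun z => (b / 2) * (u t z) ^ 2 + ((3 - b) / 2) * (deriv (u t) z) ^ 2 with hf
  have cv := hv.continuous
  have cv1 : Continuous (deriv (u t)) := hv.continuous_deriv (by norm_num)
  have cf : Continuous f := by fun_prop
  have b0 := hb.1
  have b3 := hb.2
  have f0 : ∀ x, 0 ≤ f x := fun x => by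
    have : 0 < 3 - b := by linarith
    simp only [hf]; positivity
  have sq1 : ∀ x, deriv (u t) x ^ 2 ≤ u t x ^ 2 := fun x => by
    rw [← sq_abs (deriv (u t) x)]
    have := h1 x
    gcongr
  have sq2 : ∀ x, u t x ^ 2 ≤ M ^ 2 := fun x => by
    have := hM x
    have := v0 x
    gcongr
  have fK : ∀ x, f x ≤ 3 / 2 * M ^ 2 := fun x => by
    simp only [hf]
    nlinarith [sq1 x, sq2 x]
  have fL : ∀ x, f x ≤ 3 / 2 * (u t x ^ 2 + deriv (u t) x ^ 2) := fun x => by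
    simp only [hf]
    nlinarith [sq_nonneg (u t x), sq_nonneg (deriv (u t) x)]
  have fabs : ∀ x, |f x| = f x := fun x => abs_of_nonneg (f0 x)
  obtain ⟨g1, dg, dg1, bg, bg1⟩ := aux_G cf f0 fK
  have hut : ∀ x, deriv (fun s => u s x) t = -(u t x * deriv (u t) x + g1 x) := fun x => by
    have d0 : HasDerivAt (u t) (deriv (u t) x) x :=
      (hv.differentiable (by norm_num) x).hasDerivAt
    have dF : HasDerivAt (flux b u t) (u t x * deriv (u t) x + g1 x) x := by
      have h : HasDerivAt (fun y => (1 / 2) * (u t y) ^ 2 + G f y) _ x :=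
        ((d0.pow 2).const_mul (1 / 2)).add (dg x)
      refine HasDerivAt.congr_deriv (f := flux b u t) h ?_
      simp
      ring
    have := heq t x ht
    rw [dF.deriv] at this
    linarith
  refine ⟨h1, hM, fun x => ?_, fun μ hμ => aux_ibp1 hv i2 h1 hM hμ, f,
    fun x => by rw [fabs]; exact fL x, fun μ hμ => ?_⟩
  · rw [hut x, abs_neg]
    refine (abs_add_le _ _).trans (add_le_add ?_ (bg1 x))
    rw [abs_mul, abs_of_nonneg (v0 x)]
    exact mul_le_mul (hM x) ((h1 x).trans (hM x)) (abs_nonneg _) ((v0 x).trans (hM x))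
  · obtain ⟨k1, k2, k3⟩ := aux_ibp2 hv cf h1 hM dg dg1 bg bg1
      (fun x => by rw [fabs]; exact fK x) hμ
    simp only [hut, mul_neg]
    refine ⟨k1.neg, k2, ?_⟩
    rw [integral_neg, k3, neg_neg]

lemma aux_deriv {b : ℝ} (hb : b ∈ Set.Ioo (0 : ℝ) 3) {u : ℝ → ℝ → ℝ}
    (hu : IsH2NonnegMomentumSolution b u) {t : ℝ} (ht : 3 ≤ t) :
    Integrable (fun x => (1 - Real.log t / 2) / (t * Real.sqrt t) * psimu (mu t) x * u t x
      + (sech2 (mu t * x) - phi2 (mu t) x) * deriv (fun s => u s x) t) ∧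
    HasDerivAt (Efun u) (∫ x, ((1 - Real.log t / 2) / (t * Real.sqrt t) * psimu (mu t) x * u t x
      + (sech2 (mu t * x) - phi2 (mu t) x) * deriv (fun s => u s x) t)) t := by
  have hu' := hu
  obtain ⟨hC1, hC3, -, cut, -⟩ := hu'
  obtain ⟨m0, m2, -, -⟩ := aux_mu_facts (t := t) (by norm_num; linarith)
  have ht0 : 0 < t := by linarith
  set c := mu t / 2 with hc
  have c0 : 0 < c := by positivity
  set M := ∫ x, mom u 0 x with hMdef
  set K := M * M + 3 / 2 * M ^ 2 with hK
  have hM0 : 0 ≤ M := by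
    obtain ⟨h1, hM, -⟩ := aux_time hb hu ht0
    exact ((abs_nonneg _).trans (h1 0)).trans (hM 0)
  have hK0 : 0 ≤ K := by positivity
  have hs : {s : ℝ | 2.72 < s ∧ c < mu s} ∈ nhds t := by
    have h1 : ∀ᶠ s in nhds t, 2.72 < s := lt_mem_nhds (by norm_num; linarith)
    have h2 : ∀ᶠ s in nhds t, c < mu s :=
      (aux_mu_d ht0).continuousAt.eventually (lt_mem_nhds (by rw [hc]; linarith))
    filter_upwards [h1, h2] with s a b using ⟨a, b⟩
  have main := hasDerivAt_integral_of_dominated_loc_of_deriv_le (μ := volume)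
    (F := fun s x => (sech2 (mu s * x) - phi2 (mu s) x) * u s x)
    (F' := fun s x => (1 - Real.log s / 2) / (s * Real.sqrt s) * psimu (mu s) x * u s x
      + (sech2 (mu s * x) - phi2 (mu s) x) * deriv (fun s => u s x) s)
    (bound := fun x => (66 * M * (1 + 2 / c) + 17 * K) * ((1 + |c * x|) ^ 2 * sech2 (c * x)))
    hs ?_ ?_ ?_ ?_ ?_ ?_
  · refine ⟨main.1, main.2.congr_of_eventuallyEq ?_⟩
    filter_upwards [hs] with s hs
    have s0 : 0 < s := by have := hs.1; norm_num at this; linarith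
    obtain ⟨-, -, -, hE, -⟩ := aux_time hb hu s0
    rw [← hE (mu s) (c0.trans hs.2)]
    unfold Efun mu
    congr 1
    funext x
    rw [one_div_mul_eq_div]
  · refine Filter.Eventually.of_forall fun s => Continuous.aestronglyMeasurable ?_
    exact ((aux_phic _).sub (aux_phi2c _)).mul (hC3 s).continuous
  · obtain ⟨h1, hM, -⟩ := aux_time hb hu ht0
    refine aux_intmul2 (L := M) m0.ne' ((aux_phic _).sub (aux_phi2c _)) (hC3 t).continuous
      (aux_psi_b _) fun x => ?_
    rw [abs_of_nonneg ((abs_nonneg _).trans (h1 x))]; exact hM x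
  · refine Continuous.aestronglyMeasurable ?_
    have k1 := (hC3 t).continuous
    have k2 : Continuous fun x => deriv (fun s => u s x) t :=
      cut.comp (Continuous.prodMk_right t)
    have k3 := aux_psimuc (mu t)
    have k4 := (aux_phic (mu t)).sub (aux_phi2c (mu t))
    exact ((continuous_const.mul k3).mul k1).add (k4.mul k2)
  · refine Filter.Eventually.of_forall fun x s hs => ?_
    obtain ⟨n0, n2, n3, -⟩ := aux_mu_facts hs.1.le
    have s1 : 1 < s := by have := hs.1; norm_num at this; linarith
    have s0 : 0 < s := by linarith
    obtain ⟨h1, hM, hut, -⟩ := aux_time hb hu s0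
    have u0 : 0 ≤ u s x := (abs_nonneg _).trans (h1 x)
    have hx : |c * x| ≤ |mu s * x| := by
      rw [abs_mul, abs_mul, abs_of_pos c0, abs_of_pos n0]
      have := hs.2.le
      gcongr
    have hS := aux_s_mono hx
    have S0 := aux_s_pos (c * x)
    have q1 : 1 ≤ (1 + |c * x|) ^ 2 := by nlinarith [abs_nonneg (c * x)]
    have q2 : 1 + |mu s * x| ≤ (1 + 2 / c) * (1 + |c * x|) ^ 2 := by
      have e1 : |mu s * x| ≤ 2 / c * |c * x| := by
        rw [abs_mul, abs_mul, abs_of_pos c0, abs_of_pos n0]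
        have : 2 / c * (c * |x|) = 2 * |x| := by field_simp
        rw [this]
        gcongr
      have e2 : |c * x| ≤ (1 + |c * x|) ^ 2 := by nlinarith [abs_nonneg (c * x)]
      have e3 : 2 / c * |c * x| ≤ 2 / c * (1 + |c * x|) ^ 2 := by gcongr
      linarith
    rw [Real.norm_eq_abs]
    have p1 : |(1 - Real.log s / 2) / (s * Real.sqrt s) * psimu (mu s) x * u s x|
        ≤ 66 * (((1 + 2 / c) * (1 + |c * x|) ^ 2) * sech2 (c * x)) * M := by
      rw [abs_mul, abs_mul, abs_of_nonneg u0]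
      have a1 : |(1 - Real.log s / 2) / (s * Real.sqrt s)| ≤ mu s :=
        n3.trans (div_le_self n0.le s1.le)
      have a2 := aux_psimu_b n0 n2 x
      calc |(1 - Real.log s / 2) / (s * Real.sqrt s)| * |psimu (mu s) x| * u s x
          ≤ mu s * |psimu (mu s) x| * M := by
            have := hM x
            gcongr
        _ ≤ 66 * ((1 + |mu s * x|) * sech2 (mu s * x)) * M := by gcongr
        _ ≤ _ := by
          have := (aux_s_pos (mu s * x)).le
          gcongr
    have p2 : |(sech2 (mu s * x) - phi2 (mu s) x) * deriv (fun s => u s x) s|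
        ≤ 17 * ((1 + |c * x|) ^ 2 * sech2 (c * x)) * K := by
      rw [abs_mul]
      have a1 := aux_psi_b (mu s) x
      have a2 : (1 + 4 * mu s ^ 2) ≤ 17 := by nlinarith
      have a3 : |sech2 (mu s * x) - phi2 (mu s) x| ≤ 17 * ((1 + |c * x|) ^ 2 * sech2 (c * x)) := by
        calc _ ≤ _ := a1
          _ ≤ 17 * sech2 (c * x) := by
            have := (aux_s_pos (mu s * x)).le
            gcongr
          _ ≤ _ := by nlinarith
      have := hut x
      gcongr
    refine (abs_add_le _ _).trans ((add_le_add p1 p2).trans (le_of_eq ?_))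
    ring
  · exact (aux_int c0.ne').const_mul _
  · refine Filter.Eventually.of_forall fun x s hs => ?_
    have s0 : 0 < s := by have := hs.1; norm_num at this; linarith
    have k1 := (aux_psimu_d (mu s) x).comp s (aux_mu_d s0)
    have k2 : HasDerivAt (fun s => u s x) (deriv (fun s => u s x) s) s :=
      ((hC1 x).differentiable (by norm_num) s).hasDerivAt
    refine (k1.mul k2).congr_deriv ?_
    simp only [Function.comp]
    ring

end aux

/-- For a global classical `H²` solution with nonnegative momentum,
there are `C > 0` and `t₀ > e` such that for all `t ≥ t₀`,
`|d𝓔/dt(t)| ≤ C (1/(t log²t) + log t / t^{3/2} + (1/λ(t)) ∫ sech²(x/λ(t))(u² + (∂ₓu)²) dx)`. -/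
theorem energy_functional_derivative_bound (b : ℝ) (hb : b ∈ Set.Ioo (0 : ℝ) 3)
    (u : ℝ → ℝ → ℝ) (hu : IsH2NonnegMomentumSolution b u) :
    ∃ C : ℝ, 0 < C ∧ ∃ t₀ : ℝ, Real.exp 1 < t₀ ∧ ∀ t : ℝ, t₀ ≤ t →
      |deriv (Efun u) t| ≤ C *
        (1 / (t * (Real.log t) ^ 2) + Real.log t / t ^ ((3 : ℝ) / 2)
          + (1 / lam (1 / 2) t) *
            ∫ x : ℝ, sech2 (x / lam (1 / 2) t) * ((u t x) ^ 2 + (deriv (u t) x) ^ 2)) := by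
  refine ⟨102 + 66 * ∫ z, (1 + |z|) ^ 2 * sech2 z, ?_, 3, ?_, fun t ht => ?_⟩
  · have : 0 ≤ ∫ z, (1 + |z|) ^ 2 * sech2 z := integral_nonneg fun z => by
      have := aux_s_pos z
      positivity
    positivity
  · linarith [Real.exp_one_lt_d9]
  have ht0 : 0 < t := by linarith
  obtain ⟨m0, m2, m3, m4⟩ := aux_mu_facts (t := t) (by norm_num; linarith)
  obtain ⟨i1, hd⟩ := aux_deriv hb hu ht
  obtain ⟨h1, hM, -, -, f, hf, hF⟩ := aux_time hb hu ht0
  obtain ⟨i2, i3, e⟩ := hF (mu t) m0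
  have hC3 := hu.2.1 t
  have cv := hC3.continuous
  have cv1 : Continuous (deriv (u t)) := hC3.continuous_deriv (by norm_num)
  rw [hd.deriv]
  have i4 : Integrable (fun x =>
      (1 - Real.log t / 2) / (t * Real.sqrt t) * psimu (mu t) x * u t x) := by
    refine (i1.sub i2).congr (Filter.Eventually.of_forall fun x => ?_)
    simp only [Pi.sub_apply, add_sub_cancel_right]
  rw [integral_add i4 i2, e, ← integral_add i4 i3]
  have hl : ∀ x, x / lam (1 / 2) t = mu t * x := fun x => by
    unfold mu; rw [one_div_mul_eq_div]
  rw [show 1 / lam (1 / 2) t = mu t from rfl]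
  simp only [hl]
  set J := ∫ z, (1 + |z|) ^ 2 * sech2 z with hJ
  set M := ∫ x, mom u 0 x
  have J0 : 0 ≤ J := integral_nonneg fun z => by
    have := aux_s_pos z
    positivity
  have v0 : ∀ x, 0 ≤ u t x := fun x => (abs_nonneg _).trans (h1 x)
  have i5 : Integrable (fun x => sech2 (mu t * x) * (u t x ^ 2 + deriv (u t) x ^ 2)) := by
    refine aux_intmul2 (L := M ^ 2 + M ^ 2) m0.ne' (aux_phic _) (by fun_prop) (aux_phi_b _)
      fun x => ?_
    rw [abs_of_nonneg (by positivity), ← sq_abs (deriv (u t) x)]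
    have := h1 x
    have := hM x
    have := v0 x
    have := (h1 x).trans (hM x)
    gcongr
  have i6 := aux_int m0.ne'
  have hJ' : ∫ x, (1 + |mu t * x|) ^ 2 * sech2 (mu t * x) = J / mu t := by
    have := Measure.integral_comp_mul_left (fun z => (1 + |z|) ^ 2 * sech2 z) (mu t)
    rw [this, abs_of_pos (inv_pos.2 m0), smul_eq_mul, hJ]
    field_simp
  have bd := norm_integral_le_of_norm_le (μ := volume)
    (f := fun x => (1 - Real.log t / 2) / (t * Real.sqrt t) * psimu (mu t) x * u t x
      + (phi1 (mu t) x * f x + (phi1 (mu t) x - phi3 (mu t) x) * (u t x ^ 2 / 2)))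
    (g := fun x => 102 * mu t * (sech2 (mu t * x) * (u t x ^ 2 + deriv (u t) x ^ 2))
      + 66 * (1 / (t ^ 2 * mu t)) * ((1 + |mu t * x|) ^ 2 * sech2 (mu t * x)))
    ((i5.const_mul _).add (i6.const_mul _)) (Filter.Eventually.of_forall fun x => ?_)
  · rw [integral_add (i5.const_mul _) (i6.const_mul _), integral_const_mul, integral_const_mul,
      hJ', Real.norm_eq_abs] at bd
    refine bd.trans ?_
    set I := ∫ x, sech2 (mu t * x) * (u t x ^ 2 + deriv (u t) x ^ 2)
    have I0 : 0 ≤ I := integral_nonneg fun x => by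
      have := aux_s_pos (mu t * x)
      positivity
    have hlog : 0 ≤ Real.log t := Real.log_nonneg (by linarith)
    have e2 : 66 * (1 / (t ^ 2 * mu t)) * (J / mu t) = 66 * J * (1 / (t * Real.log t ^ 2)) := by
      rw [← m4]; field_simp
    rw [e2]
    have a1 : 0 ≤ 1 / (t * Real.log t ^ 2) := by positivity
    have a2 : 0 ≤ Real.log t / t ^ ((3 : ℝ) / 2) := by positivity
    have a3 : 0 ≤ mu t * I := by positivity
    have a4 := mul_nonneg J0 a2
    have a5 := mul_nonneg J0 a3
    nlinarith
  · set y := mu t * x with hy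
    have S0 := aux_s_pos y
    rw [Real.norm_eq_abs]
    have p1 : |(1 - Real.log t / 2) / (t * Real.sqrt t) * psimu (mu t) x * u t x|
        ≤ 66 * (mu t * (sech2 y * u t x ^ 2)
          + 1 / (t ^ 2 * mu t) * ((1 + |y|) ^ 2 * sech2 y)) := by
      rw [abs_mul, abs_mul, abs_of_nonneg (v0 x)]
      have a2 := aux_psimu_b m0 m2 x
      calc |(1 - Real.log t / 2) / (t * Real.sqrt t)| * |psimu (mu t) x| * u t x
          ≤ mu t / t * |psimu (mu t) x| * u t x := by
            have := v0 x
            gcongr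
        _ = (mu t * |psimu (mu t) x|) * (u t x / t) := by ring
        _ ≤ 66 * ((1 + |y|) * sech2 y) * (u t x / t) := by
            have := v0 x
            gcongr
        _ = 66 * (sech2 y * ((1 + |y|) / t * u t x)) := by ring
        _ ≤ 66 * (sech2 y * (mu t * u t x ^ 2 + ((1 + |y|) / t) ^ 2 / mu t)) := by
            have q : (1 + |y|) / t * u t x ≤ mu t * u t x ^ 2 + ((1 + |y|) / t) ^ 2 / mu t := by
              have a0 : 0 ≤ (1 + |y|) / t := by positivity
              generalize (1 + |y|) / t = a at a0
              have : mu t * u t x ^ 2 + a ^ 2 / mu t = (mu t ^ 2 * u t x ^ 2 + a ^ 2) / mu t := by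
                field_simp
              rw [this, le_div_iff₀ m0]
              nlinarith [sq_nonneg (mu t * u t x - a), sq_nonneg (mu t * u t x), sq_nonneg a]
            gcongr
        _ = _ := by field_simp
    have p2 : |phi1 (mu t) x * f x| ≤
        3 * (mu t * (sech2 y * (u t x ^ 2 + deriv (u t) x ^ 2))) := by
      rw [abs_mul]
      calc _ ≤ (2 * mu t * sech2 y) * (3 / 2 * (u t x ^ 2 + deriv (u t) x ^ 2)) :=
            mul_le_mul (aux_phi1_b m0.le x) (hf x) (abs_nonneg _) (by positivity)
        _ = _ := by ring
    have p3 : |(phi1 (mu t) x - phi3 (mu t) x) * (u t x ^ 2 / 2)| ≤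
        33 * (mu t * (sech2 y * u t x ^ 2)) := by
      rw [abs_mul, abs_of_nonneg (by positivity : 0 ≤ u t x ^ 2 / 2)]
      have q : 2 * mu t + 16 * mu t ^ 3 ≤ 66 * mu t := by
        have : mu t ^ 2 ≤ 4 := by nlinarith
        nlinarith
      calc _ ≤ ((66 * mu t) * sech2 y) * (u t x ^ 2 / 2) := by
            refine mul_le_mul_of_nonneg_right ((aux_psix_b m0.le x).trans ?_) (by positivity)
            exact mul_le_mul_of_nonneg_right q S0.le
        _ = _ := by ring
    have p4 : 0 ≤ mu t * (sech2 y * u t x ^ 2) := by positivity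
    have p5 : 0 ≤ mu t * (sech2 y * deriv (u t) x ^ 2) := by positivity
    refine (abs_add_le _ _).trans ((add_le_add p1 ((abs_add_le _ _).trans (add_le_add p2 p3))).trans ?_)
    nlinarith
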